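/- arXiv:2501.06610 — 7 statements merged into one kernel-verified Lean document; each statement's English description precedes it below -/
import Mathlib

section
/- Let d ≥ 1, let F : ℝ^d → ℝ be twice continuously differentiable with M-Lipschitz Hessian, let ν > 0, x ∈ ℝ^d, and let (u_1, …, u_d) be an orthonormal basis of ℝ^d. Defining b_j := (F(x + νu_j) − F(x − νu_j))/(2ν), one has ∑_{j=1}^d (b_j − ⟨∇F(x), u_j⟩)² ≤ d M² ν⁴ / 36. -/
open scoped RealInnerProductSpace

section CentralDifference

variable {E : Type*} [NormedAddCommGroup E] [NormedSpace ℝ E]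

/-- Second derivatives along `v`, for a function whose second derivative is Lipschitz. -/
theorem abs_fderiv_fderiv_sub_le_of_lipschitz {F : E → ℝ} {M : ℝ}
    (hLip : ∀ x y : E, ‖iteratedFDeriv ℝ 2 F x - iteratedFDeriv ℝ 2 F y‖ ≤ M * ‖x - y‖)
    (x y v : E) :
    |fderiv ℝ (fderiv ℝ F) x v v - fderiv ℝ (fderiv ℝ F) y v v| ≤ M * ‖x - y‖ * ‖v‖ ^ 2 := by
  have h := (iteratedFDeriv ℝ 2 F x - iteratedFDeriv ℝ 2 F y).le_of_opNorm_le (hLip x y)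
    (fun _ => v)
  simpa [iteratedFDeriv_two_apply] using h

/-- The central difference of a `C²` function with `M`-Lipschitz second derivative approximates
the directional derivative to third order in the sampling radius. -/
theorem abs_central_difference_sub_fderiv_le {F : E → ℝ} {M : ℝ} (hF : ContDiff ℝ 2 F)
    (hLip : ∀ x y : E, ‖iteratedFDeriv ℝ 2 F x - iteratedFDeriv ℝ 2 F y‖ ≤ M * ‖x - y‖)
    (x v : E) {ν : ℝ} (hν : 0 ≤ ν) :
    |F (x + ν • v) - F (x - ν • v) - 2 * ν * fderiv ℝ F x v| ≤ M * ‖v‖ ^ 3 / 3 * ν ^ 3 := by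
  have hd : Differentiable ℝ F := hF.differentiable (by norm_num)
  have hd' : Differentiable ℝ (fderiv ℝ F) :=
    (hF.fderiv_right (m := 1) (by norm_num)).differentiable (by norm_num)
  have hadd (t : ℝ) : HasDerivAt (fun s : ℝ => x + s • v) v t := by
    simpa using ((hasDerivAt_id t).smul_const v).const_add x
  have hsub (t : ℝ) : HasDerivAt (fun s : ℝ => x - s • v) (-v) t := by
    simpa using ((hasDerivAt_id t).smul_const v).const_sub x
  have hφ (t : ℝ) : HasDerivAt
      (fun s : ℝ => F (x + s • v) - F (x - s • v) - 2 * s * fderiv ℝ F x v)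
      (fderiv ℝ F (x + t • v) v + fderiv ℝ F (x - t • v) v - 2 * fderiv ℝ F x v) t := by
    have h := (((hd _).hasFDerivAt.comp_hasDerivAt t (hadd t)).sub
      ((hd _).hasFDerivAt.comp_hasDerivAt t (hsub t))).sub
      (((hasDerivAt_id t).const_mul 2).mul_const (fderiv ℝ F x v))
    refine h.congr_deriv ?_
    simp
  have hφ' (t : ℝ) : HasDerivAt
      (fun s : ℝ => fderiv ℝ F (x + s • v) v + fderiv ℝ F (x - s • v) v - 2 * fderiv ℝ F x v)
      (fderiv ℝ (fderiv ℝ F) (x + t • v) v v - fderiv ℝ (fderiv ℝ F) (x - t • v) v v) t := by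
    have h := ((((hd' _).hasFDerivAt.comp_hasDerivAt t (hadd t)).clm_apply
      (hasDerivAt_const t v)).add
      (((hd' _).hasFDerivAt.comp_hasDerivAt t (hsub t)).clm_apply
      (hasDerivAt_const t v))).sub_const (2 * fderiv ℝ F x v)
    refine h.congr_deriv ?_
    simp [sub_eq_add_neg]
  have hfirst : ∀ t : ℝ, 0 ≤ t →
      ‖fderiv ℝ F (x + t • v) v + fderiv ℝ F (x - t • v) v - 2 * fderiv ℝ F x v‖
        ≤ M * ‖v‖ ^ 3 * t ^ 2 := by
    intro t ht
    refine image_norm_le_of_norm_deriv_right_le_deriv_boundary (a := 0) (b := t)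
      (B := fun s => M * ‖v‖ ^ 3 * s ^ 2) (B' := fun s => M * ‖v‖ ^ 3 * (2 * s))
      (fun s _ => (hφ' s).continuousAt.continuousWithinAt)
      (fun s _ => (hφ' s).hasDerivWithinAt) ?_ (fun s => ?_) (fun s hs => ?_)
      (Set.right_mem_Icc.2 ht)
    · simp [two_mul]
    · simpa using (hasDerivAt_pow 2 s).const_mul (M * ‖v‖ ^ 3)
    · have hnorm : ‖(x + s • v) - (x - s • v)‖ = 2 * s * ‖v‖ := by
        rw [show (x + s • v) - (x - s • v) = (2 * s) • v by module, norm_smul,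
          Real.norm_of_nonneg (by linarith [hs.1])]
      have h := abs_fderiv_fderiv_sub_le_of_lipschitz hLip (x + s • v) (x - s • v) v
      rw [hnorm] at h
      rw [Real.norm_eq_abs]
      linarith
  refine image_norm_le_of_norm_deriv_right_le_deriv_boundary (a := 0) (b := ν)
    (B := fun s => M * ‖v‖ ^ 3 / 3 * s ^ 3) (B' := fun s => M * ‖v‖ ^ 3 * s ^ 2)
    (fun s _ => (hφ s).continuousAt.continuousWithinAt)
    (fun s _ => (hφ s).hasDerivWithinAt) ?_ (fun s => ?_) (fun s hs => hfirst s hs.1)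
    (Set.right_mem_Icc.2 hν)
  · simp
  · refine ((hasDerivAt_pow 3 s).const_mul (M * ‖v‖ ^ 3 / 3)).congr_deriv ?_
    push_cast
    ring

end CentralDifference

theorem central_diff_coordinatewise_error_sum_bound
    (d : ℕ) (hd : 1 ≤ d)
    (F : EuclideanSpace ℝ (Fin d) → ℝ) (M : ℝ) (hM : 0 ≤ M)
    (hF : ContDiff ℝ 2 F)
    (hLip : ∀ x y : EuclideanSpace ℝ (Fin d),
      ‖iteratedFDeriv ℝ 2 F x - iteratedFDeriv ℝ 2 F y‖ ≤ M * ‖x - y‖)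
    (ν : ℝ) (hν : 0 < ν) (x : EuclideanSpace ℝ (Fin d))
    (u : OrthonormalBasis (Fin d) ℝ (EuclideanSpace ℝ (Fin d)))
    (b : Fin d → ℝ)
    (hb : ∀ j, b j = (F (x + ν • u j) - F (x - ν • u j)) / (2 * ν)) :
    ∑ j : Fin d, (b j - ⟪gradient F x, u j⟫) ^ 2 ≤ d * M ^ 2 * ν ^ 4 / 36 := by
  have hterm (j : Fin d) : (b j - ⟪gradient F x, u j⟫) ^ 2 ≤ (M * ν ^ 2 / 6) ^ 2 := by
    have hgrad : ⟪gradient F x, u j⟫ = fderiv ℝ F x (u j) := by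
      simp [gradient]
    have h := abs_central_difference_sub_fderiv_le hF hLip x (u j) hν.le
    rw [u.norm_eq_one] at h
    have hquot : b j - ⟪gradient F x, u j⟫ =
        (F (x + ν • u j) - F (x - ν • u j) - 2 * ν * fderiv ℝ F x (u j)) / (2 * ν) := by
      rw [hb, hgrad]
      field_simp
    refine sq_le_sq' (abs_le.1 ?_).1 (abs_le.1 ?_).2 <;>
    · rw [hquot, abs_div, abs_of_pos (by positivity : 0 < 2 * ν), div_le_iff₀ (by positivity)]
      linarith
  calc ∑ j : Fin d, (b j - ⟪gradient F x, u j⟫) ^ 2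
      ≤ ∑ _j : Fin d, (M * ν ^ 2 / 6) ^ 2 := Finset.sum_le_sum fun j _ => hterm j
    _ = d * M ^ 2 * ν ^ 4 / 36 := by
      rw [Finset.sum_const, Finset.card_univ, Fintype.card_fin, nsmul_eq_mul]
      ring
end

section
/- Let d ≥ 1, let F : ℝ^d → ℝ be twice continuously differentiable with M-Lipschitz Hessian, let ν > 0, x ∈ ℝ^d, and let (u_1, …, u_d) be an orthonormal basis of ℝ^d. Defining b_j := (F(x + νu_j) − F(x − νu_j))/(2ν), the central finite-difference gradient estimator satisfies ‖∑_{j=1}^d b_j u_j − ∇F(x)‖ ≤ √d · M ν² / 6. -/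
open scoped RealInnerProductSpace

/-- A function vanishing at `0` whose derivative is bounded by `C * t ^ n` is bounded by
`C / (n + 1) * t ^ (n + 1)`. -/
theorem norm_le_of_norm_hasDerivAt_le_pow {E : Type*} [NormedAddCommGroup E] [NormedSpace ℝ E]
    {g g' : ℝ → E} {C : ℝ} (n : ℕ) (hg : ∀ t, HasDerivAt g (g' t) t) (h0 : g 0 = 0)
    (hbound : ∀ t, 0 ≤ t → ‖g' t‖ ≤ C * t ^ n) {t : ℝ} (ht : 0 ≤ t) :
    ‖g t‖ ≤ C / (n + 1) * t ^ (n + 1) := by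
  have hB : ∀ s : ℝ, HasDerivAt (fun s : ℝ => C / (n + 1) * s ^ (n + 1)) (C * s ^ n) s := by
    intro s
    refine ((hasDerivAt_pow (n + 1) s).const_mul (C / ((n : ℝ) + 1))).congr_deriv ?_
    have : (n : ℝ) + 1 ≠ 0 := by positivity
    rw [Nat.add_sub_cancel]
    push_cast
    field_simp
  exact image_norm_le_of_norm_deriv_right_le_deriv_boundary (a := 0) (b := t)
    (fun s _ => (hg s).continuousAt.continuousWithinAt) (fun s _ => (hg s).hasDerivWithinAt)
    (by simp [h0]) hB (fun s hs => hbound s hs.1) ⟨ht, le_rfl⟩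

/-- The error of the symmetric difference quotient along `v` is of second order when the second
derivative is Lipschitz. -/
theorem abs_central_diff_sub_fderiv_le {E : Type*} [NormedAddCommGroup E] [NormedSpace ℝ E]
    {F : E → ℝ} {M : ℝ} (hF : ContDiff ℝ 2 F)
    (hLip : ∀ x y, ‖iteratedFDeriv ℝ 2 F x - iteratedFDeriv ℝ 2 F y‖ ≤ M * ‖x - y‖)
    {ν : ℝ} (hν : 0 < ν) (x v : E) :
    |(F (x + ν • v) - F (x - ν • v)) / (2 * ν) - fderiv ℝ F x v| ≤ M * ‖v‖ ^ 3 * ν ^ 2 / 6 := by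
  have hp : ∀ t : ℝ, HasDerivAt (fun t : ℝ => x + t • v) v t := fun t => by
    simpa using ((hasDerivAt_id t).smul_const v).const_add x
  have hm : ∀ t : ℝ, HasDerivAt (fun t : ℝ => x - t • v) (-v) t := fun t => by
    simpa using ((hasDerivAt_id t).smul_const v).const_sub x
  have hd1 : ∀ y, HasFDerivAt F (fderiv ℝ F y) y := fun y =>
    (hF.differentiable (by norm_num) y).hasFDerivAt
  have hd2 : ∀ y, HasFDerivAt (fun y => fderiv ℝ F y v)
      ((fderiv ℝ (fderiv ℝ F) y).flip v) y := fun y => by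
    have h := ((hF.fderiv_right (m := 1) (by norm_num)).differentiable (by norm_num) y).hasFDerivAt
    simpa using h.clm_apply (hasFDerivAt_const v y)
  have hg : ∀ t : ℝ, HasDerivAt
      (fun t : ℝ => F (x + t • v) - F (x - t • v) - 2 * t * fderiv ℝ F x v)
      (fderiv ℝ F (x + t • v) v + fderiv ℝ F (x - t • v) v - 2 * fderiv ℝ F x v) t := by
    intro t
    have h1 := (hd1 (x + t • v)).comp_hasDerivAt t (hp t)
    have h2 := (hd1 (x - t • v)).comp_hasDerivAt t (hm t)
    have h3 := ((hasDerivAt_id t).const_mul 2).mul_const (fderiv ℝ F x v)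
    refine ((h1.sub h2).sub h3).congr_deriv ?_
    simp
  have hg' : ∀ t : ℝ, HasDerivAt
      (fun t : ℝ => fderiv ℝ F (x + t • v) v + fderiv ℝ F (x - t • v) v - 2 * fderiv ℝ F x v)
      (fderiv ℝ (fderiv ℝ F) (x + t • v) v v - fderiv ℝ (fderiv ℝ F) (x - t • v) v v) t := by
    intro t
    have h1 := (hd2 (x + t • v)).comp_hasDerivAt t (hp t)
    have h2 := (hd2 (x - t • v)).comp_hasDerivAt t (hm t)
    refine ((h1.add h2).sub_const (2 * fderiv ℝ F x v)).congr_deriv ?_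
    simp [sub_eq_add_neg]
  have hbound : ∀ t : ℝ, 0 ≤ t →
      ‖fderiv ℝ (fderiv ℝ F) (x + t • v) v v - fderiv ℝ (fderiv ℝ F) (x - t • v) v v‖
        ≤ (2 * M * ‖v‖ ^ 3) * t ^ 1 := by
    intro t ht
    have h1 := (iteratedFDeriv ℝ 2 F (x + t • v) - iteratedFDeriv ℝ 2 F (x - t • v)).le_opNorm
      ![v, v]
    simp only [sub_apply, iteratedFDeriv_two_apply, Fin.prod_univ_two,
      Matrix.cons_val_zero, Matrix.cons_val_one] at h1
    have h2 : ‖x + t • v - (x - t • v)‖ = 2 * t * ‖v‖ := by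
      rw [show x + t • v - (x - t • v) = (2 * t) • v by module, norm_smul,
        Real.norm_of_nonneg (by positivity)]
    refine (h1.trans (mul_le_mul_of_nonneg_right (hLip _ _) (by positivity))).trans_eq ?_
    rw [h2]
    ring
  have hb1 : ∀ t : ℝ, 0 ≤ t →
      ‖fderiv ℝ F (x + t • v) v + fderiv ℝ F (x - t • v) v - 2 * fderiv ℝ F x v‖
        ≤ M * ‖v‖ ^ 3 * t ^ 2 := by
    intro t ht
    refine (norm_le_of_norm_hasDerivAt_le_pow 1 hg' (by simp; ring) hbound ht).trans_eq ?_
    push_cast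
    ring
  have hb2 := norm_le_of_norm_hasDerivAt_le_pow 2 hg (by simp) hb1 hν.le
  rw [show (F (x + ν • v) - F (x - ν • v)) / (2 * ν) - fderiv ℝ F x v
      = (F (x + ν • v) - F (x - ν • v) - 2 * ν * fderiv ℝ F x v) / (2 * ν) by field_simp,
    abs_div, abs_of_pos (show 0 < 2 * ν by positivity), div_le_iff₀ (by positivity)]
  refine hb2.trans_eq ?_
  push_cast
  ring

/-- A vector whose coordinates in an orthonormal basis are bounded by `C` has norm at most
`√(card ι) * C`. -/
theorem OrthonormalBasis.norm_le_sqrt_card_mul {ι E : Type*} [Fintype ι] [NormedAddCommGroup E]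
    [InnerProductSpace ℝ E] (u : OrthonormalBasis ι ℝ E) {w : E} {C : ℝ} (hC : 0 ≤ C)
    (h : ∀ i, |⟪u i, w⟫| ≤ C) : ‖w‖ ≤ Real.sqrt (Fintype.card ι) * C := by
  rw [← Real.sqrt_sq hC, ← Real.sqrt_mul (by positivity)]
  refine Real.le_sqrt_of_sq_le ?_
  rw [← u.sum_sq_norm_inner_right w]
  refine (Finset.sum_le_card_nsmul _ _ (C ^ 2) fun i _ => ?_).trans_eq (by simp)
  exact pow_le_pow_left₀ (norm_nonneg _) (h i) 2

theorem central_diff_full_basis_gradient_error_bound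
    (d : ℕ) (hd : 1 ≤ d)
    (F : EuclideanSpace ℝ (Fin d) → ℝ) (M : ℝ) (hM : 0 ≤ M)
    (hF : ContDiff ℝ 2 F)
    (hLip : ∀ x y : EuclideanSpace ℝ (Fin d),
      ‖iteratedFDeriv ℝ 2 F x - iteratedFDeriv ℝ 2 F y‖ ≤ M * ‖x - y‖)
    (ν : ℝ) (hν : 0 < ν) (x : EuclideanSpace ℝ (Fin d))
    (u : OrthonormalBasis (Fin d) ℝ (EuclideanSpace ℝ (Fin d)))
    (b : Fin d → ℝ)
    (hb : ∀ j, b j = (F (x + ν • u j) - F (x - ν • u j)) / (2 * ν)) :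
    ‖(∑ j : Fin d, b j • u j) - gradient F x‖ ≤ Real.sqrt d * M * ν ^ 2 / 6 := by
  have hcoord : ∀ i, |⟪u i, (∑ j : Fin d, b j • u j) - gradient F x⟫| ≤ M * ν ^ 2 / 6 := by
    intro i
    rw [inner_sub_right, u.orthonormal.inner_right_fintype, real_inner_comm, gradient,
      InnerProductSpace.toDual_symm_apply, hb i]
    simpa using abs_central_diff_sub_fderiv_le hF hLip hν x (u i)
  refine (u.norm_le_sqrt_card_mul (by positivity) hcoord).trans_eq ?_
  rw [Fintype.card_fin]
  ring
end

section
/- Let d ≥ 1, let f, F : ℝ^d → ℝ be twice continuously differentiable with Lipschitz continuous Hessians with constants M_f and M_F respectively, where M_F ≤ M_f. For every x, u ∈ ℝ^d and ν > 0, defining c := (f(x + νu) − f(x − νu))/(2ν) − (F(x + νu) − F(x − νu))/(2ν), one has c² ≤ 2⟨u, ∇f(x) − ∇F(x)⟩² + (2/9) M_f² ν⁴ ‖u‖⁶. -/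
open scoped RealInnerProductSpace

section CentralDifference

variable {E : Type*} [NormedAddCommGroup E] [NormedSpace ℝ E]

theorem hasDerivAt_comp_add_smul {G : Type*} [NormedAddCommGroup G] [NormedSpace ℝ G]
    {g : E → G} (hg : Differentiable ℝ g) (x u : E) (t : ℝ) :
    HasDerivAt (fun s : ℝ => g (x + s • u)) (fderiv ℝ g (x + t • u) u) t := by
  have hline : HasDerivAt (fun s : ℝ => x + s • u) u t := by
    simpa using ((hasDerivAt_id t).smul_const u).const_add x
  exact (hg (x + t • u)).hasFDerivAt.comp_hasDerivAt t hline

theorem abs_le_cube_of_abs_deriv2_le {p p' p'' : ℝ → ℝ} {K b : ℝ}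
    (hp : ∀ t, HasDerivAt p (p' t) t) (hp' : ∀ t, HasDerivAt p' (p'' t) t)
    (h0 : p 0 = 0) (h0' : p' 0 = 0) (hK : ∀ t, 0 ≤ t → |p'' t| ≤ 2 * K * t) (hb : 0 ≤ b) :
    |p b| ≤ K * b ^ 3 / 3 := by
  have hd : ∀ t, 0 ≤ t → |p' t| ≤ K * t ^ 2 := by
    intro t ht
    refine image_norm_le_of_norm_deriv_right_le_deriv_boundary
      (B := fun s => K * s ^ 2) (B' := fun s => 2 * K * s)
      (fun s _ => (hp' s).continuousAt.continuousWithinAt)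
      (fun s _ => (hp' s).hasDerivWithinAt) (by simp [h0']) (fun s => ?_)
      (fun s hs => hK s hs.1) (Set.right_mem_Icc.2 ht)
    exact ((hasDerivAt_pow 2 s).const_mul K).congr_deriv (by push_cast; ring)
  refine image_norm_le_of_norm_deriv_right_le_deriv_boundary
    (B := fun s => K * s ^ 3 / 3) (B' := fun s => K * s ^ 2)
    (fun s _ => (hp s).continuousAt.continuousWithinAt)
    (fun s _ => (hp s).hasDerivWithinAt) (by simp [h0]) (fun s => ?_)
    (fun s hs => hd s hs.1) (Set.right_mem_Icc.2 hb)
  exact (((hasDerivAt_pow 3 s).const_mul K).div_const 3).congr_deriv (by push_cast; ring)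

theorem abs_central_diff_quotient_sub_fderiv_le {h : E → ℝ} {M : ℝ} (hh : ContDiff ℝ 2 h)
    (hLip : ∀ x y : E, ‖iteratedFDeriv ℝ 2 h x - iteratedFDeriv ℝ 2 h y‖ ≤ M * ‖x - y‖)
    (x u : E) {ν : ℝ} (hν : 0 < ν) :
    |(h (x + ν • u) - h (x - ν • u)) / (2 * ν) - fderiv ℝ h x u| ≤ M * ν ^ 2 * ‖u‖ ^ 3 / 6 := by
  have hdiff : Differentiable ℝ h := hh.differentiable (by norm_num)
  have hdiff' : Differentiable ℝ (fderiv ℝ h) :=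
    (hh.fderiv_right (m := 1) (by norm_num)).differentiable (by norm_num)
  have key := abs_le_cube_of_abs_deriv2_le (b := ν) (K := M * ‖u‖ ^ 3)
    (p := fun t => h (x + t • u) - h (x + t • -u) - t * (2 * fderiv ℝ h x u))
    (p' := fun t => fderiv ℝ h (x + t • u) u - fderiv ℝ h (x + t • -u) (-u)
      - 1 * (2 * fderiv ℝ h x u))
    (p'' := fun t => fderiv ℝ (fderiv ℝ h) (x + t • u) u u
      - fderiv ℝ (fderiv ℝ h) (x + t • -u) (-u) (-u))
    (fun t => ((hasDerivAt_comp_add_smul hdiff x u t).sub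
      (hasDerivAt_comp_add_smul hdiff x (-u) t)).sub ((hasDerivAt_id t).mul_const _))
    (fun t => by
      have h1 := (hasDerivAt_comp_add_smul hdiff' x u t).clm_apply (hasDerivAt_const t u)
      have h2 := (hasDerivAt_comp_add_smul hdiff' x (-u) t).clm_apply (hasDerivAt_const t (-u))
      simpa using (h1.sub h2).sub_const (1 * (2 * fderiv ℝ h x u)))
    (by simp) (by simp; ring)
    (fun t ht => by
      have h1 := (iteratedFDeriv ℝ 2 h (x + t • u)
        - iteratedFDeriv ℝ 2 h (x + t • -u)).le_opNorm ![u, u]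
      have h2 := hLip (x + t • u) (x + t • -u)
      have h3 : x + t • u - (x + t • -u) = (2 * t) • u := by module
      rw [h3, norm_smul, Real.norm_of_nonneg (by positivity)] at h2
      simp only [sub_apply, iteratedFDeriv_two_apply,
        Fin.prod_univ_two, Matrix.cons_val_zero, Matrix.cons_val_one, Real.norm_eq_abs] at h1
      simp only [map_neg, neg_apply, neg_neg]
      refine h1.trans ((mul_le_mul_of_nonneg_right h2 (by positivity)).trans_eq (by ring)))
    hν.le
  have hquot : (h (x + ν • u) - h (x - ν • u)) / (2 * ν) - fderiv ℝ h x u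
      = (h (x + ν • u) - h (x + ν • -u) - ν * (2 * fderiv ℝ h x u)) / (2 * ν) := by
    rw [smul_neg, ← sub_eq_add_neg]
    field_simp
  rw [hquot, abs_div, abs_of_pos (by positivity : 0 < 2 * ν), div_le_iff₀ (by positivity)]
  exact key.trans_eq (by ring)

end CentralDifference

theorem central_diff_quotient_difference_sq_bound
    (d : ℕ) (hd : 1 ≤ d)
    (f F : EuclideanSpace ℝ (Fin d) → ℝ) (Mf MF : ℝ)
    (hMf : 0 ≤ Mf) (hMF : 0 ≤ MF) (hMFf : MF ≤ Mf)
    (hf : ContDiff ℝ 2 f)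
    (hLipf : ∀ x y : EuclideanSpace ℝ (Fin d),
      ‖iteratedFDeriv ℝ 2 f x - iteratedFDeriv ℝ 2 f y‖ ≤ Mf * ‖x - y‖)
    (hF : ContDiff ℝ 2 F)
    (hLipF : ∀ x y : EuclideanSpace ℝ (Fin d),
      ‖iteratedFDeriv ℝ 2 F x - iteratedFDeriv ℝ 2 F y‖ ≤ MF * ‖x - y‖)
    (x u : EuclideanSpace ℝ (Fin d)) (ν : ℝ) (hν : 0 < ν)
    (c : ℝ)
    (hc : c = (f (x + ν • u) - f (x - ν • u)) / (2 * ν)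
            - (F (x + ν • u) - F (x - ν • u)) / (2 * ν)) :
    c ^ 2 ≤ 2 * ⟪u, gradient f x - gradient F x⟫ ^ 2
      + (2 / 9) * Mf ^ 2 * ν ^ 4 * ‖u‖ ^ 6 := by
  have ef := abs_central_diff_quotient_sub_fderiv_le hf hLipf x u hν
  have eF := abs_central_diff_quotient_sub_fderiv_le hF hLipF x u hν
  have hgrad : ⟪u, gradient f x - gradient F x⟫ = fderiv ℝ f x u - fderiv ℝ F x u := by
    rw [inner_sub_right, real_inner_comm, real_inner_comm _ u]
    simp [gradient]
  rw [hgrad]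
  have hM : MF * ν ^ 2 * ‖u‖ ^ 3 / 6 ≤ Mf * ν ^ 2 * ‖u‖ ^ 3 / 6 := by gcongr
  set a := fderiv ℝ f x u - fderiv ℝ F x u with ha
  have he : |c - a| ≤ Mf * ν ^ 2 * ‖u‖ ^ 3 / 3 := by
    rw [abs_le] at ef eF ⊢
    constructor <;> linarith [ef.1, ef.2, eF.1, eF.2]
  have hsq : (c - a) ^ 2 ≤ (Mf * ν ^ 2 * ‖u‖ ^ 3 / 3) ^ 2 :=
    sq_le_sq.2 (he.trans (le_abs_self _))
  nlinarith [sq_nonneg (c - 2 * a)]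
end

section
/- Let d ≥ 1, let (Ω, μ) be a probability space and f : ℝ^d × Ω → ℝ be such that for every ω the function f(·, ω) is twice continuously differentiable with M_f-Lipschitz Hessian; let F : ℝ^d → ℝ be twice continuously differentiable with M_F-Lipschitz Hessian where M_F ≤ M_f; assume E_ω[∇f(x, ω)] = ∇F(x) and E_ω[‖∇f(x, ω) − ∇F(x)‖²] ≤ β₁‖∇F(x)‖² + β₂ for constants β₁, β₂ ≥ 0. Fix x ∈ ℝ^d, ν > 0, γ > 0, finitely many vectors u_1, …, u_m ∈ ℝ^d, and define c_j(ω) := (f(x + νu_j, ω) − f(x − νu_j, ω))/(2ν) − (F(x + νu_j) − F(x − νu_j))/(2ν). Then E_ω[‖γ ∑_{j=1}^m c_j(ω) u_j‖²] ≤ 2 γ² m ∑_{j=1}^m [ (β₁‖∇F(x)‖² + β₂)‖u_j‖⁴ + (1/9) M_f² ν⁴ ‖u_j‖⁸ ]. -/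
open MeasureTheory
open scoped RealInnerProductSpace

/-- The central difference of a function with `M`-Lipschitz Hessian approximates the directional
derivative to third order. -/
theorem abs_sub_sub_two_mul_fderiv_le_of_lipschitz_hessian
    {E : Type*} [NormedAddCommGroup E] [NormedSpace ℝ E] {h : E → ℝ} {M : ℝ}
    (hh : ContDiff ℝ 2 h)
    (hLip : ∀ x y : E, ‖iteratedFDeriv ℝ 2 h x - iteratedFDeriv ℝ 2 h y‖ ≤ M * ‖x - y‖)
    (x v : E) :
    |h (x + v) - h (x - v) - 2 * fderiv ℝ h x v| ≤ M * ‖v‖ ^ 3 / 3 := by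
  have hd : ∀ y, HasFDerivAt h (fderiv ℝ h y) y := fun y =>
    (hh.differentiable (by norm_num) y).hasFDerivAt
  have hd2 : ∀ y, HasFDerivAt (fderiv ℝ h) (fderiv ℝ (fderiv ℝ h) y) y := fun y =>
    (((hh.fderiv_right (m := 1) (by norm_num)).differentiable (by norm_num)) y).hasFDerivAt
  have hp : ∀ t : ℝ, HasDerivAt (fun t : ℝ => x + t • v) v t := fun t => by
    simpa using ((hasDerivAt_id t).smul_const v).const_add x
  have hm : ∀ t : ℝ, HasDerivAt (fun t : ℝ => x - t • v) (-v) t := fun t => by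
    simpa using ((hasDerivAt_id t).smul_const v).const_sub x
  let g : ℝ → ℝ := fun t => h (x + t • v) - h (x - t • v) - t * (2 * fderiv ℝ h x v)
  let g' : ℝ → ℝ := fun t =>
    fderiv ℝ h (x + t • v) v + fderiv ℝ h (x - t • v) v - 2 * fderiv ℝ h x v
  let g'' : ℝ → ℝ := fun t =>
    fderiv ℝ (fderiv ℝ h) (x + t • v) v v - fderiv ℝ (fderiv ℝ h) (x - t • v) v v
  have hg : ∀ t, HasDerivAt g (g' t) t := fun t => by
    have := (((hd _).comp_hasDerivAt t (hp t)).sub ((hd _).comp_hasDerivAt t (hm t))).sub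
      ((hasDerivAt_id t).mul_const (2 * fderiv ℝ h x v))
    refine this.congr_deriv ?_
    simp [g']
  have hg' : ∀ t, HasDerivAt g' (g'' t) t := fun t => by
    have h1 := ((hd2 _).comp_hasDerivAt t (hp t)).clm_apply (hasDerivAt_const t v)
    have h2 := ((hd2 _).comp_hasDerivAt t (hm t)).clm_apply (hasDerivAt_const t v)
    refine ((h1.add h2).sub_const (2 * fderiv ℝ h x v)).congr_deriv ?_
    simp [g'', sub_eq_add_neg]
  have bound'' : ∀ t, 0 ≤ t → ‖g'' t‖ ≤ M * ‖v‖ ^ 3 * (2 * t) := fun t ht => by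
    have h1 := (iteratedFDeriv ℝ 2 h (x + t • v) - iteratedFDeriv ℝ 2 h (x - t • v)).le_opNorm
      ![v, v]
    have h2 := hLip (x + t • v) (x - t • v)
    have h3 : ‖x + t • v - (x - t • v)‖ = 2 * t * ‖v‖ := by
      rw [show x + t • v - (x - t • v) = (2 * t) • v by module, norm_smul, Real.norm_eq_abs,
        abs_of_nonneg (by positivity)]
    rw [h3] at h2
    simp only [sub_apply, iteratedFDeriv_two_apply, Fin.prod_univ_two,
      Matrix.cons_val_zero, Matrix.cons_val_one] at h1
    calc ‖g'' t‖ ≤ _ := h1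
      _ ≤ M * (2 * t * ‖v‖) * (‖v‖ * ‖v‖) := by gcongr
      _ = _ := by ring
  have bound' : ∀ t, 0 ≤ t → ‖g' t‖ ≤ M * ‖v‖ ^ 3 * t ^ 2 := fun t ht =>
    image_norm_le_of_norm_deriv_right_le_deriv_boundary (a := 0) (b := t)
      (fun s _ => (hg' s).continuousAt.continuousWithinAt)
      (fun s _ => (hg' s).hasDerivWithinAt)
      (B := fun s => M * ‖v‖ ^ 3 * s ^ 2) (by simp [g', two_mul])
      (fun s => by simpa using (hasDerivAt_pow 2 s).const_mul (M * ‖v‖ ^ 3))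
      (fun s hs => bound'' s hs.1) ⟨ht, le_rfl⟩
  have bound : ‖g 1‖ ≤ M * ‖v‖ ^ 3 / 3 * 1 ^ 3 :=
    image_norm_le_of_norm_deriv_right_le_deriv_boundary (a := 0) (b := 1)
      (fun s _ => (hg s).continuousAt.continuousWithinAt)
      (fun s _ => (hg s).hasDerivWithinAt)
      (B := fun s => M * ‖v‖ ^ 3 / 3 * s ^ 3) (by simp [g])
      (fun s => ((hasDerivAt_pow 3 s).const_mul (M * ‖v‖ ^ 3 / 3)).congr_deriv
        (show _ = M * ‖v‖ ^ 3 * s ^ 2 by norm_num; ring))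
      (fun s hs => bound' s hs.1) ⟨zero_le_one, le_rfl⟩
  simpa [g] using bound

/-- The scaled form of the third-order estimate, in terms of the gradient. -/
theorem abs_centralDiff_sub_inner_gradient_le
    {E : Type*} [NormedAddCommGroup E] [InnerProductSpace ℝ E] [CompleteSpace E]
    {h : E → ℝ} {M : ℝ} (hh : ContDiff ℝ 2 h)
    (hLip : ∀ x y : E, ‖iteratedFDeriv ℝ 2 h x - iteratedFDeriv ℝ 2 h y‖ ≤ M * ‖x - y‖)
    (x v : E) {ν : ℝ} (hν : 0 < ν) :
    |(h (x + ν • v) - h (x - ν • v)) / (2 * ν) - ⟪gradient h x, v⟫| ≤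
      M * ν ^ 2 * ‖v‖ ^ 3 / 6 := by
  have key := abs_sub_sub_two_mul_fderiv_le_of_lipschitz_hessian hh hLip x (ν • v)
  have hgrad : ⟪gradient h x, v⟫ = fderiv ℝ h x v := by
    simp [gradient]
  rw [hgrad, show (h (x + ν • v) - h (x - ν • v)) / (2 * ν) - fderiv ℝ h x v =
      (h (x + ν • v) - h (x - ν • v) - 2 * fderiv ℝ h x (ν • v)) / (2 * ν) by
    rw [map_smul, smul_eq_mul]; field_simp, abs_div, abs_of_pos (by positivity : 0 < 2 * ν),
    div_le_iff₀ (by positivity)]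
  rw [norm_smul, Real.norm_eq_abs, abs_of_pos hν] at key
  linarith

/-- Cauchy–Schwarz for a finite sum of vectors. -/
theorem norm_sum_sq_le_card_mul_sum_norm_sq {ι E : Type*} [SeminormedAddCommGroup E]
    (s : Finset ι) (w : ι → E) :
    ‖∑ j ∈ s, w j‖ ^ 2 ≤ s.card * ∑ j ∈ s, ‖w j‖ ^ 2 :=
  (pow_le_pow_left₀ (norm_nonneg _) (norm_sum_le s w) 2).trans sq_sum_le_card_mul_sum_sq

theorem stochastic_central_diff_sampling_error_bound
    (d : ℕ) (hd : 1 ≤ d)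
    {Ω : Type*} [MeasurableSpace Ω] (μ : Measure Ω) [IsProbabilityMeasure μ]
    (f : EuclideanSpace ℝ (Fin d) → Ω → ℝ)
    (F : EuclideanSpace ℝ (Fin d) → ℝ) (Mf MF : ℝ)
    (hMf : 0 ≤ Mf) (hMF : 0 ≤ MF) (hMFf : MF ≤ Mf)
    (hf : ∀ ω, ContDiff ℝ 2 (fun y => f y ω))
    (hLipf : ∀ ω, ∀ x y : EuclideanSpace ℝ (Fin d),
      ‖iteratedFDeriv ℝ 2 (fun z => f z ω) x - iteratedFDeriv ℝ 2 (fun z => f z ω) y‖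
        ≤ Mf * ‖x - y‖)
    (hF : ContDiff ℝ 2 F)
    (hLipF : ∀ x y : EuclideanSpace ℝ (Fin d),
      ‖iteratedFDeriv ℝ 2 F x - iteratedFDeriv ℝ 2 F y‖ ≤ MF * ‖x - y‖)
    (β₁ β₂ : ℝ) (hβ₁ : 0 ≤ β₁) (hβ₂ : 0 ≤ β₂)
    (hgradInt : ∀ y : EuclideanSpace ℝ (Fin d),
      Integrable (fun ω => gradient (fun z => f z ω) y) μ)
    (hmean : ∀ y : EuclideanSpace ℝ (Fin d),
      (∫ ω, gradient (fun z => f z ω) y ∂μ) = gradient F y)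
    (hvarInt : ∀ y : EuclideanSpace ℝ (Fin d),
      Integrable (fun ω => ‖gradient (fun z => f z ω) y - gradient F y‖ ^ 2) μ)
    (hvar : ∀ y : EuclideanSpace ℝ (Fin d),
      (∫ ω, ‖gradient (fun z => f z ω) y - gradient F y‖ ^ 2 ∂μ)
        ≤ β₁ * ‖gradient F y‖ ^ 2 + β₂)
    (x : EuclideanSpace ℝ (Fin d)) (ν γ : ℝ) (hν : 0 < ν) (hγ : 0 < γ)
    (m : ℕ) (u : Fin m → EuclideanSpace ℝ (Fin d))
    (c : Fin m → Ω → ℝ)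
    (hc : ∀ j ω, c j ω = (f (x + ν • u j) ω - f (x - ν • u j) ω) / (2 * ν)
                       - (F (x + ν • u j) - F (x - ν • u j)) / (2 * ν))
    (hInt : Integrable (fun ω => ‖γ • ∑ j : Fin m, c j ω • u j‖ ^ 2) μ) :
    (∫ ω, ‖γ • ∑ j : Fin m, c j ω • u j‖ ^ 2 ∂μ)
      ≤ 2 * γ ^ 2 * m * ∑ j : Fin m,
          ((β₁ * ‖gradient F x‖ ^ 2 + β₂) * ‖u j‖ ^ 4
            + (1 / 9) * Mf ^ 2 * ν ^ 4 * ‖u j‖ ^ 8) := by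
  have hpt : ∀ j ω, ‖c j ω • u j‖ ^ 2 ≤
      2 * (‖gradient (fun z => f z ω) x - gradient F x‖ ^ 2 * ‖u j‖ ^ 4
        + (1 / 9) * Mf ^ 2 * ν ^ 4 * ‖u j‖ ^ 8) := by
    intro j ω
    set G := gradient (fun z => f z ω) x - gradient F x with hG
    have h1 := abs_centralDiff_sub_inner_gradient_le (hf ω) (hLipf ω) x (u j) hν
    have h2 := abs_centralDiff_sub_inner_gradient_le hF hLipF x (u j) hν
    have h3 : MF * ν ^ 2 * ‖u j‖ ^ 3 / 6 ≤ Mf * ν ^ 2 * ‖u j‖ ^ 3 / 6 := by gcongr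
    have herr : |c j ω - ⟪G, u j⟫| ≤ Mf * ν ^ 2 * ‖u j‖ ^ 3 / 3 := by
      rw [hc, hG, inner_sub_left]
      rw [abs_le] at h1 h2 ⊢
      constructor <;> linarith [h1.1, h1.2, h2.1, h2.2]
    have hinner : |⟪G, u j⟫| ≤ ‖G‖ * ‖u j‖ := abs_real_inner_le_norm _ _
    have herr_sq := sq_le_sq' (abs_le.mp herr).1 (abs_le.mp herr).2
    have hinner_sq := sq_le_sq' (abs_le.mp hinner).1 (abs_le.mp hinner).2
    have hcsq : c j ω ^ 2 ≤
        2 * ((‖G‖ * ‖u j‖) ^ 2 + (Mf * ν ^ 2 * ‖u j‖ ^ 3 / 3) ^ 2) := by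
      nlinarith [sq_nonneg (c j ω - 2 * ⟪G, u j⟫)]
    rw [norm_smul, mul_pow, Real.norm_eq_abs, sq_abs]
    calc c j ω ^ 2 * ‖u j‖ ^ 2 ≤ _ := mul_le_mul_of_nonneg_right hcsq (sq_nonneg _)
      _ = _ := by ring
  have hintj : ∀ j, Integrable (fun ω =>
      ‖gradient (fun z => f z ω) x - gradient F x‖ ^ 2 * ‖u j‖ ^ 4
        + (1 / 9) * Mf ^ 2 * ν ^ 4 * ‖u j‖ ^ 8) μ := fun j =>
    ((hvarInt x).mul_const _).add (integrable_const _)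
  calc (∫ ω, ‖γ • ∑ j : Fin m, c j ω • u j‖ ^ 2 ∂μ)
      ≤ ∫ ω, 2 * γ ^ 2 * m * ∑ j : Fin m,
          (‖gradient (fun z => f z ω) x - gradient F x‖ ^ 2 * ‖u j‖ ^ 4
            + (1 / 9) * Mf ^ 2 * ν ^ 4 * ‖u j‖ ^ 8) ∂μ := by
        refine integral_mono hInt
          ((integrable_finsetSum _ fun j _ => hintj j).const_mul _) fun ω => ?_
        have hsum := norm_sum_sq_le_card_mul_sum_norm_sq Finset.univ fun j => c j ω • u j
        rw [Finset.card_univ, Fintype.card_fin] at hsum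
        have hterms := Finset.sum_le_sum fun j (_ : j ∈ Finset.univ) => hpt j ω
        rw [← Finset.mul_sum] at hterms
        dsimp only
        rw [norm_smul, mul_pow, Real.norm_eq_abs, sq_abs]
        calc γ ^ 2 * ‖∑ j : Fin m, c j ω • u j‖ ^ 2
            ≤ γ ^ 2 * (m * (2 * ∑ j : Fin m,
              (‖gradient (fun z => f z ω) x - gradient F x‖ ^ 2 * ‖u j‖ ^ 4
                + (1 / 9) * Mf ^ 2 * ν ^ 4 * ‖u j‖ ^ 8))) := by
              gcongr
              exact hsum.trans (by gcongr)
          _ = _ := by ring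
    _ = 2 * γ ^ 2 * m * ∑ j : Fin m,
          ((∫ ω, ‖gradient (fun z => f z ω) x - gradient F x‖ ^ 2 ∂μ) * ‖u j‖ ^ 4
            + (1 / 9) * Mf ^ 2 * ν ^ 4 * ‖u j‖ ^ 8) := by
        rw [integral_const_mul, integral_finsetSum _ fun j _ => hintj j]
        congr 1
        refine Finset.sum_congr rfl fun j _ => ?_
        rw [integral_add ((hvarInt x).mul_const _) (integrable_const _), integral_mul_const]
        simp
    _ ≤ _ := by
        gcongr
        exact hvar x
end

section
/- Let d ≥ 1, let (Ω, μ) be a probability space and f : ℝ^d × Ω → ℝ be such that for every ω the function f(·, ω) is twice continuously differentiable with M_f-Lipschitz Hessian; let F : ℝ^d → ℝ be twice continuously differentiable with M_F-Lipschitz Hessian where M_F ≤ M_f; assume E_ω[∇f(x, ω)] = ∇F(x) and E_ω[‖∇f(x, ω) − ∇F(x)‖²] ≤ β₁‖∇F(x)‖² + β₂ for constants β₁, β₂ ≥ 0. Fix x ∈ ℝ^d and ν > 0, and for a function h : ℝ^d → ℝ define the central finite-difference gradient ∇^{FD}h(x) := ∑_{j=1}^d ((h(x + νe_j) − h(x −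 νe_j))/(2ν)) e_j, where (e_j) is the canonical orthonormal basis. Then E_ω[‖∇^{FD}f(·, ω)(x) − ∇^{FD}F(x)‖²] ≤ 4β₁‖∇^{FD}F(x)‖² + 2β₂ + ((2 + β₁)/9) M_f² ν⁴ d. -/
open MeasureTheory

/-- The central finite-difference gradient estimator of `h` at `x` with sampling
radius `ν`, built from the canonical orthonormal basis of `EuclideanSpace ℝ (Fin d)`. -/
noncomputable def centralFDGrad (d : ℕ) (ν : ℝ) (h : EuclideanSpace ℝ (Fin d) → ℝ)
    (x : EuclideanSpace ℝ (Fin d)) : EuclideanSpace ℝ (Fin d) :=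
  ∑ j : Fin d,
    ((h (x + ν • EuclideanSpace.single j (1 : ℝ)) - h (x - ν • EuclideanSpace.single j (1 : ℝ)))
        / (2 * ν)) • EuclideanSpace.single j (1 : ℝ)

/-- Third-order Taylor estimate for the central difference of a function whose second derivative
is `M`-Lipschitz. -/
lemma abs_sub_sub_two_mul_fderiv_le {E : Type*} [NormedAddCommGroup E] [NormedSpace ℝ E]
    {h : E → ℝ} {M : ℝ} (hh : ContDiff ℝ 2 h)
    (hLip : ∀ x y : E, ‖iteratedFDeriv ℝ 2 h x - iteratedFDeriv ℝ 2 h y‖ ≤ M * ‖x - y‖)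
    (x v : E) (hv : ‖v‖ = 1) {ν : ℝ} (hν : 0 ≤ ν) :
    |h (x + ν • v) - h (x - ν • v) - 2 * ν * fderiv ℝ h x v| ≤ M * ν ^ 3 / 3 := by
  have hd : Differentiable ℝ h := hh.differentiable (by norm_num)
  have hd' : Differentiable ℝ (fderiv ℝ h) :=
    (hh.fderiv_right (m := 1) (by norm_num)).differentiable (by norm_num)
  have line_add : ∀ t : ℝ, HasDerivAt (fun t : ℝ => x + t • v) v t := fun t => by
    simpa using ((hasDerivAt_id t).smul_const v).const_add x
  have line_sub : ∀ t : ℝ, HasDerivAt (fun t : ℝ => x - t • v) (-v) t := fun t => by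
    simpa using ((hasDerivAt_id t).smul_const v).const_sub x
  have first : ∀ t : ℝ, HasDerivAt
      (fun t : ℝ => h (x + t • v) - h (x - t • v) - 2 * t * fderiv ℝ h x v)
      (fderiv ℝ h (x + t • v) v + fderiv ℝ h (x - t • v) v - 2 * fderiv ℝ h x v) t := by
    intro t
    have h1 := (hd (x + t • v)).hasFDerivAt.comp_hasDerivAt t (line_add t)
    have h2 := (hd (x - t • v)).hasFDerivAt.comp_hasDerivAt t (line_sub t)
    have h3 := ((hasDerivAt_id t).const_mul 2).mul_const (fderiv ℝ h x v)
    refine ((h1.sub h2).sub h3).congr_deriv ?_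
    simp
  have second : ∀ t : ℝ, HasDerivAt
      (fun t : ℝ => fderiv ℝ h (x + t • v) v + fderiv ℝ h (x - t • v) v - 2 * fderiv ℝ h x v)
      (fderiv ℝ (fderiv ℝ h) (x + t • v) v v - fderiv ℝ (fderiv ℝ h) (x - t • v) v v) t := by
    intro t
    have h1 : HasDerivAt (fun t : ℝ => fderiv ℝ h (x + t • v))
        (fderiv ℝ (fderiv ℝ h) (x + t • v) v) t :=
      (hd' (x + t • v)).hasFDerivAt.comp_hasDerivAt t (line_add t)
    have h2 : HasDerivAt (fun t : ℝ => fderiv ℝ h (x - t • v))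
        (fderiv ℝ (fderiv ℝ h) (x - t • v) (-v)) t :=
      (hd' (x - t • v)).hasFDerivAt.comp_hasDerivAt t (line_sub t)
    have h3 := h1.clm_apply (hasDerivAt_const t v)
    have h4 := h2.clm_apply (hasDerivAt_const t v)
    refine ((h3.add h4).sub_const (2 * fderiv ℝ h x v)).congr_deriv ?_
    simp [sub_eq_add_neg]
  have second_le : ∀ t : ℝ, 0 ≤ t →
      ‖fderiv ℝ (fderiv ℝ h) (x + t • v) v v - fderiv ℝ (fderiv ℝ h) (x - t • v) v v‖
        ≤ 2 * M * t := by
    intro t ht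
    have h1 := (iteratedFDeriv ℝ 2 h (x + t • v)
      - iteratedFDeriv ℝ 2 h (x - t • v)).le_opNorm ![v, v]
    simp only [ContinuousMultilinearMap.sub_apply, iteratedFDeriv_two_apply,
      Fin.prod_univ_two, Matrix.cons_val_zero, Matrix.cons_val_one, hv, mul_one] at h1
    refine h1.trans ((hLip _ _).trans_eq ?_)
    have h2 : x + t • v - (x - t • v) = (2 * t) • v := by module
    rw [h2, norm_smul, hv, Real.norm_of_nonneg (by positivity)]
    ring
  have first_le : ∀ t ∈ Set.Icc 0 ν,
      ‖fderiv ℝ h (x + t • v) v + fderiv ℝ h (x - t • v) v - 2 * fderiv ℝ h x v‖ ≤ M * t ^ 2 := by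
    refine image_norm_le_of_norm_deriv_right_le_deriv_boundary
      (fun t _ => (second t).continuousAt.continuousWithinAt)
      (fun t _ => (second t).hasDerivWithinAt) (B := fun t => M * t ^ 2) (B' := fun t => 2 * M * t)
      ?_ (fun t => ?_) (fun t ht => second_le t ht.1)
    · simp [two_mul]
    · exact ((hasDerivAt_pow 2 t).const_mul M).congr_deriv (by push_cast; ring)
  refine image_norm_le_of_norm_deriv_right_le_deriv_boundary
      (fun t _ => (first t).continuousAt.continuousWithinAt)
      (fun t _ => (first t).hasDerivWithinAt) (B := fun t => M * t ^ 3 / 3)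
      (B' := fun t => M * t ^ 2)
      ?_ (fun t => ?_) (fun t ht => first_le t ⟨ht.1, ht.2.le⟩) ⟨hν, le_rfl⟩
  · simp
  · exact (((hasDerivAt_pow 3 t).const_mul M).div_const 3).congr_deriv (by push_cast; ring)

lemma centralFDGrad_apply (d : ℕ) (ν : ℝ) (h : EuclideanSpace ℝ (Fin d) → ℝ)
    (x : EuclideanSpace ℝ (Fin d)) (j : Fin d) :
    centralFDGrad d ν h x j =
      (h (x + ν • EuclideanSpace.single j (1 : ℝ)) - h (x - ν • EuclideanSpace.single j (1 : ℝ)))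
        / (2 * ν) := by
  simp [centralFDGrad, Pi.single_apply]

lemma abs_centralFDGrad_sub_gradient_apply_le {d : ℕ} {h : EuclideanSpace ℝ (Fin d) → ℝ} {M : ℝ}
    (hh : ContDiff ℝ 2 h)
    (hLip : ∀ x y : EuclideanSpace ℝ (Fin d),
      ‖iteratedFDeriv ℝ 2 h x - iteratedFDeriv ℝ 2 h y‖ ≤ M * ‖x - y‖)
    (x : EuclideanSpace ℝ (Fin d)) {ν : ℝ} (hν : 0 < ν) (j : Fin d) :
    |(centralFDGrad d ν h x - gradient h x) j| ≤ M * ν ^ 2 / 6 := by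
  have grad_apply : gradient h x j = fderiv ℝ h x (EuclideanSpace.single j (1 : ℝ)) := by
    rw [← InnerProductSpace.toDual_symm_apply, EuclideanSpace.inner_single_right]
    simp [gradient]
  have key := abs_sub_sub_two_mul_fderiv_le hh hLip x (EuclideanSpace.single j (1 : ℝ))
    (by simp) hν.le
  rw [PiLp.sub_apply, centralFDGrad_apply, grad_apply, div_sub' (by positivity), abs_div,
    abs_of_pos (by positivity : 0 < 2 * ν), div_le_iff₀ (by positivity)]
  exact key.trans_eq (by ring)

lemma EuclideanSpace.norm_sq_le_of_abs_apply_le {ι : Type*} [Fintype ι] {v : EuclideanSpace ℝ ι}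
    {c : ℝ} (hv : ∀ j, |v j| ≤ c) : ‖v‖ ^ 2 ≤ Fintype.card ι * c ^ 2 := by
  rw [EuclideanSpace.norm_sq_eq]
  calc ∑ j, ‖v j‖ ^ 2 ≤ ∑ _j : ι, c ^ 2 :=
        Finset.sum_le_sum fun j _ => pow_le_pow_left₀ (norm_nonneg _) (hv j) 2
    _ = Fintype.card ι * c ^ 2 := by simp

lemma norm_add_sq_le_two_mul {E : Type*} [SeminormedAddCommGroup E] (a b : E) :
    ‖a + b‖ ^ 2 ≤ 2 * ‖a‖ ^ 2 + 2 * ‖b‖ ^ 2 := by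
  have := pow_le_pow_left₀ (norm_nonneg _) (norm_add_le a b) 2
  nlinarith [sq_nonneg (‖a‖ - ‖b‖)]

theorem stochastic_central_fd_gradient_variance_bound
    (d : ℕ) (hd : 1 ≤ d)
    {Ω : Type*} [MeasurableSpace Ω] (μ : Measure Ω) [IsProbabilityMeasure μ]
    (f : EuclideanSpace ℝ (Fin d) → Ω → ℝ)
    (F : EuclideanSpace ℝ (Fin d) → ℝ) (Mf MF : ℝ)
    (hMf : 0 ≤ Mf) (hMF : 0 ≤ MF) (hMFf : MF ≤ Mf)
    (hf : ∀ ω, ContDiff ℝ 2 (fun y => f y ω))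
    (hLipf : ∀ ω, ∀ x y : EuclideanSpace ℝ (Fin d),
      ‖iteratedFDeriv ℝ 2 (fun z => f z ω) x - iteratedFDeriv ℝ 2 (fun z => f z ω) y‖
        ≤ Mf * ‖x - y‖)
    (hF : ContDiff ℝ 2 F)
    (hLipF : ∀ x y : EuclideanSpace ℝ (Fin d),
      ‖iteratedFDeriv ℝ 2 F x - iteratedFDeriv ℝ 2 F y‖ ≤ MF * ‖x - y‖)
    (β₁ β₂ : ℝ) (hβ₁ : 0 ≤ β₁) (hβ₂ : 0 ≤ β₂)
    (hgradInt : ∀ y : EuclideanSpace ℝ (Fin d),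
      Integrable (fun ω => gradient (fun z => f z ω) y) μ)
    (hmean : ∀ y : EuclideanSpace ℝ (Fin d),
      (∫ ω, gradient (fun z => f z ω) y ∂μ) = gradient F y)
    (hvarInt : ∀ y : EuclideanSpace ℝ (Fin d),
      Integrable (fun ω => ‖gradient (fun z => f z ω) y - gradient F y‖ ^ 2) μ)
    (hvar : ∀ y : EuclideanSpace ℝ (Fin d),
      (∫ ω, ‖gradient (fun z => f z ω) y - gradient F y‖ ^ 2 ∂μ)
        ≤ β₁ * ‖gradient F y‖ ^ 2 + β₂)
    (x : EuclideanSpace ℝ (Fin d)) (ν : ℝ) (hν : 0 < ν)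
    (hInt : Integrable
      (fun ω => ‖centralFDGrad d ν (fun z => f z ω) x - centralFDGrad d ν F x‖ ^ 2) μ) :
    (∫ ω, ‖centralFDGrad d ν (fun z => f z ω) x - centralFDGrad d ν F x‖ ^ 2 ∂μ)
      ≤ 4 * β₁ * ‖centralFDGrad d ν F x‖ ^ 2 + 2 * β₂
        + ((2 + β₁) / 9) * Mf ^ 2 * ν ^ 4 * d := by
  have err_sub : ∀ ω, ‖centralFDGrad d ν (fun z => f z ω) x - gradient (fun z => f z ω) x
      - (centralFDGrad d ν F x - gradient F x)‖ ^ 2 ≤ d * (Mf * ν ^ 2 / 3) ^ 2 := by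
    intro ω
    have h1 := EuclideanSpace.norm_sq_le_of_abs_apply_le (c := Mf * ν ^ 2 / 3)
      (v := centralFDGrad d ν (fun z => f z ω) x - gradient (fun z => f z ω) x
      - (centralFDGrad d ν F x - gradient F x)) fun j => by
        have hfj := abs_centralFDGrad_sub_gradient_apply_le (hf ω) (hLipf ω) x hν j
        have hFj := abs_centralFDGrad_sub_gradient_apply_le hF hLipF x hν j
        have hM : MF * ν ^ 2 ≤ Mf * ν ^ 2 := by gcongr
        rw [PiLp.sub_apply]
        exact (abs_sub _ _).trans (by linarith)
    simpa using h1
  have grad_le : ‖gradient F x‖ ^ 2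
      ≤ 2 * ‖centralFDGrad d ν F x‖ ^ 2 + 2 * (d * (Mf * ν ^ 2 / 6) ^ 2) := by
    have h1 := EuclideanSpace.norm_sq_le_of_abs_apply_le
      (abs_centralFDGrad_sub_gradient_apply_le hF hLipF x hν)
    rw [Fintype.card_fin] at h1
    have h2 : d * (MF * ν ^ 2 / 6) ^ 2 ≤ d * (Mf * ν ^ 2 / 6) ^ 2 := by gcongr
    have h3 := norm_add_sq_le_two_mul (centralFDGrad d ν F x)
      (-(centralFDGrad d ν F x - gradient F x))
    rw [norm_neg, ← sub_eq_add_neg, sub_sub_cancel] at h3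
    linarith
  have pointwise : ∀ ω, ‖centralFDGrad d ν (fun z => f z ω) x - centralFDGrad d ν F x‖ ^ 2
      ≤ 2 * ‖gradient (fun z => f z ω) x - gradient F x‖ ^ 2
        + 2 * (d * (Mf * ν ^ 2 / 3) ^ 2) := by
    intro ω
    have h1 := norm_add_sq_le_two_mul (gradient (fun z => f z ω) x - gradient F x)
      (centralFDGrad d ν (fun z => f z ω) x - gradient (fun z => f z ω) x
        - (centralFDGrad d ν F x - gradient F x))
    have h2 : gradient (fun z => f z ω) x - gradient F x
        + (centralFDGrad d ν (fun z => f z ω) x - gradient (fun z => f z ω) x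
        - (centralFDGrad d ν F x - gradient F x))
        = centralFDGrad d ν (fun z => f z ω) x - centralFDGrad d ν F x := by abel
    rw [h2] at h1
    linarith [err_sub ω]
  have hbound := integral_mono hInt
    (((hvarInt x).const_mul 2).add (integrable_const (2 * (d * (Mf * ν ^ 2 / 3) ^ 2)))) pointwise
  simp only [Pi.add_apply] at hbound
  rw [integral_add ((hvarInt x).const_mul 2) (integrable_const _), integral_const_mul,
    integral_const, probReal_univ, one_smul] at hbound
  have hβ := mul_le_mul_of_nonneg_left grad_le hβ₁
  linarith [hvar x]
end

section
/- Let (Ω, P) be a probability space, K ≥ 1 an integer, α > 0, χ ≥ 0, F* ∈ ℝ, and p ∈ (0, 1]. Let V_0, …, V_K and G_0, …, G_{K−1} be integrable real-valued random variables on Ω such that G_k ≥ 0 almost surely for all 0 ≤ k ≤ K−1, V_K ≥ F* almost surely, E[V_0] > F*, and E[V_{k+1}] ≤ E[V_k] − (α/4) E[G_k] + αχ for all 0 ≤ k ≤ K−1. Then P( min_{0 ≤ k ≤ K−1} G_k > 4(E[V_0] − F*)/(Kαp) + 4χ/p ) ≤ p; equivalently, with probability at least 1 − p, min_{0 ≤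 k ≤ K−1} G_k ≤ 4(E[V_0] − F*)/(Kαp) + 4χ/p. -/
open MeasureTheory

/-- Markov's inequality for the minimum of finitely many nonnegative random variables, in terms of
the sum of their expectations. -/
theorem card_mul_measureReal_lt_inf'_le_sum_integral {Ω ι : Type*} [MeasurableSpace Ω]
    (P : Measure Ω) [IsFiniteMeasure P] (s : Finset ι) (hs : s.Nonempty) (G : ι → Ω → ℝ)
    (hint : ∀ k ∈ s, Integrable (G k) P) (hnonneg : ∀ k ∈ s, ∀ᵐ ω ∂P, 0 ≤ G k ω)
    {t : ℝ} (ht : 0 ≤ t) :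
    s.card * t * P.real {ω | t < s.inf' hs (fun k => G k ω)} ≤ ∑ k ∈ s, ∫ ω, G k ω ∂P := by
  have hsum_nonneg : 0 ≤ᵐ[P] fun ω => ∑ k ∈ s, G k ω := by
    filter_upwards [(ae_ball_iff s.countable_toSet).2 hnonneg] with ω hω
    exact Finset.sum_nonneg hω
  have hsubset : {ω | t < s.inf' hs (fun k => G k ω)} ⊆ {ω | s.card * t ≤ ∑ k ∈ s, G k ω} := by
    intro ω hω
    rw [Set.mem_ofPred_eq, Finset.lt_inf'_iff] at hω
    simpa using Finset.card_nsmul_le_sum s (fun k => G k ω) t fun k hk => (hω k hk).le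
  calc s.card * t * P.real {ω | t < s.inf' hs (fun k => G k ω)}
      ≤ s.card * t * P.real {ω | s.card * t ≤ ∑ k ∈ s, G k ω} := by gcongr; finiteness
    _ ≤ ∫ ω, ∑ k ∈ s, G k ω ∂P :=
        mul_meas_ge_le_integral_of_nonneg hsum_nonneg (integrable_finsetSum s hint) _
    _ = ∑ k ∈ s, ∫ ω, G k ω ∂P := integral_finsetSum s hint

/-- Telescoping a descent inequality `v (k + 1) ≤ v k - c * g k + d`. -/
theorem mul_sum_le_of_descent {K : ℕ} {v g : ℕ → ℝ} {c d : ℝ}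
    (h : ∀ k < K, v (k + 1) ≤ v k - c * g k + d) :
    c * ∑ k ∈ Finset.range K, g k ≤ v 0 - v K + K * d := by
  rw [Finset.mul_sum]
  calc ∑ k ∈ Finset.range K, c * g k
      ≤ ∑ k ∈ Finset.range K, ((v k - v (k + 1)) + d) :=
        Finset.sum_le_sum fun k hk => by linarith [h k (Finset.mem_range.1 hk)]
    _ = v 0 - v K + K * d := by
        rw [Finset.sum_add_distrib, Finset.sum_range_sub']
        simp

theorem sublinear_convergence_high_probability
    {Ω : Type*} [MeasurableSpace Ω] (P : Measure Ω) [IsProbabilityMeasure P]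
    (K : ℕ) (hK : 1 ≤ K) (α χ Fstar : ℝ) (p : ℝ) (hα : 0 < α) (hχ : 0 ≤ χ)
    (hp0 : 0 < p) (hp1 : p ≤ 1)
    (V G : ℕ → Ω → ℝ)
    (hVint : ∀ k ≤ K, Integrable (V k) P)
    (hGint : ∀ k < K, Integrable (G k) P)
    (hGnonneg : ∀ k < K, ∀ᵐ ω ∂P, 0 ≤ G k ω)
    (hVK : ∀ᵐ ω ∂P, Fstar ≤ V K ω)
    (hV0 : Fstar < ∫ ω, V 0 ω ∂P)
    (hdescent : ∀ k < K,
      (∫ ω, V (k + 1) ω ∂P) ≤ (∫ ω, V k ω ∂P) - (α / 4) * (∫ ω, G k ω ∂P) + α * χ) :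
    P {ω | 4 * ((∫ ω', V 0 ω' ∂P) - Fstar) / (K * α * p) + 4 * χ / p
          < (Finset.range K).inf'
              (Finset.nonempty_range_iff.mpr (Nat.one_le_iff_ne_zero.mp hK))
              (fun k => G k ω)}
      ≤ ENNReal.ofReal p := by
  have hK0 : (0 : ℝ) < K := by exact_mod_cast hK
  have hFstar : Fstar ≤ ∫ ω, V K ω ∂P := by
    simpa using integral_mono_ae (integrable_const Fstar) (hVint K le_rfl) hVK
  have hsum := mul_sum_le_of_descent (v := fun k => ∫ ω, V k ω ∂P) (g := fun k => ∫ ω, G k ω ∂P)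
    hdescent
  set t := 4 * ((∫ ω', V 0 ω' ∂P) - Fstar) / (K * α * p) + 4 * χ / p with ht_def
  have hgap : 0 < (∫ ω', V 0 ω' ∂P) - Fstar := sub_pos.2 hV0
  have ht : 0 < t := by positivity
  have hthreshold : α / 4 * (K * t * p) = (∫ ω', V 0 ω' ∂P) - Fstar + K * (α * χ) := by
    rw [ht_def]
    field_simp
  have hmarkov := card_mul_measureReal_lt_inf'_le_sum_integral P (Finset.range K)
    (Finset.nonempty_range_iff.mpr (Nat.one_le_iff_ne_zero.mp hK)) G
    (fun k hk => hGint k (Finset.mem_range.1 hk))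
    (fun k hk => hGnonneg k (Finset.mem_range.1 hk)) ht.le
  rw [Finset.card_range] at hmarkov
  have hbound : ∑ k ∈ Finset.range K, ∫ ω, G k ω ∂P ≤ K * t * p :=
    le_of_mul_le_mul_left (by linarith) (by positivity : 0 < α / 4)
  rw [ENNReal.le_ofReal_iff_toReal_le (measure_ne_top _ _) hp0.le]
  exact le_of_mul_le_mul_left (hmarkov.trans hbound) (mul_pos hK0 ht)
end

section
/- Let (Ω, P) be a probability space, α > 0, F* ∈ ℝ, ε > 0, p ∈ (0, 1], and χ ≥ 0 with χ ≤ εp/8. Let K ≥ 1 be an integer with K ≥ 8(E[V_0] − F*)/(εpα), and let V_0, …, V_K and G_0, …, G_{K−1} be integrable real-valued random variables on Ω such that G_k ≥ 0 almost surely for all 0 ≤ k ≤ K−1, V_K ≥ F* almost surely, E[V_0] > F*, and E[V_{k+1}] ≤ E[V_k] − (α/4) E[G_k] + αχ for all 0 ≤ k ≤ K−1. Then P( min_{0 ≤ k ≤ K−1} G_k ≤ ε ) ≥ 1 − p. -/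
open MeasureTheory

/-- Markov's inequality, read as a lower bound on the probability of the complementary event. -/
theorem ofReal_one_sub_le_measure_le_of_integral_le
    {Ω : Type*} [MeasurableSpace Ω] {P : Measure Ω} [IsProbabilityMeasure P]
    {f : Ω → ℝ} {ε p : ℝ} (hε : 0 < ε) (hf : Integrable f P) (hf0 : 0 ≤ᵐ[P] f)
    (h : ∫ ω, f ω ∂P ≤ ε * p) :
    ENNReal.ofReal (1 - p) ≤ P {ω | f ω ≤ ε} := by
  have hmarkov : P.real {ω | ε ≤ f ω} ≤ p :=
    le_of_mul_le_mul_left ((mul_meas_ge_le_integral_of_nonneg hf0 hf ε).trans h) hε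
  have hcover : 1 ≤ P.real {ω | f ω ≤ ε} + P.real {ω | ε ≤ f ω} := by
    rw [← probReal_univ (μ := P)]
    exact (measureReal_mono fun ω _ => le_total (f ω) ε).trans (measureReal_union_le _ _)
  rw [← ofReal_measureReal]
  exact ENNReal.ofReal_le_ofReal (by linarith)

/-- Telescoping a descent inequality. -/
theorem le_sub_sum_range_of_descent {v g : ℕ → ℝ} {a b : ℝ} {K : ℕ}
    (h : ∀ k < K, v (k + 1) ≤ v k - a * g k + b) :
    v K ≤ v 0 - a * ∑ k ∈ Finset.range K, g k + K * b := by
  induction K with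
  | zero => simp
  | succ n ih =>
    have hn := ih fun k hk => h k (by omega)
    have hstep := h n (by omega)
    rw [Finset.sum_range_succ]
    push_cast
    linarith

theorem iteration_complexity_epsilon_accurate
    {Ω : Type*} [MeasurableSpace Ω] (P : Measure Ω) [IsProbabilityMeasure P]
    (α Fstar ε p χ : ℝ) (hα : 0 < α) (hε : 0 < ε)
    (hp0 : 0 < p) (hp1 : p ≤ 1) (hχ0 : 0 ≤ χ) (hχ : χ ≤ ε * p / 8)
    (K : ℕ) (hK : 1 ≤ K)
    (V G : ℕ → Ω → ℝ)
    (hKbig : 8 * ((∫ ω, V 0 ω ∂P) - Fstar) / (ε * p * α) ≤ K)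
    (hVint : ∀ k ≤ K, Integrable (V k) P)
    (hGint : ∀ k < K, Integrable (G k) P)
    (hGnonneg : ∀ k < K, ∀ᵐ ω ∂P, 0 ≤ G k ω)
    (hVK : ∀ᵐ ω ∂P, Fstar ≤ V K ω)
    (hV0 : Fstar < ∫ ω, V 0 ω ∂P)
    (hdescent : ∀ k < K,
      (∫ ω, V (k + 1) ω ∂P) ≤ (∫ ω, V k ω ∂P) - (α / 4) * (∫ ω, G k ω ∂P) + α * χ) :
    ENNReal.ofReal (1 - p)
      ≤ P {ω | (Finset.range K).inf'
            (Finset.nonempty_range_iff.mpr (Nat.one_le_iff_ne_zero.mp hK))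
            (fun k => G k ω) ≤ ε} := by
  have hFK : Fstar ≤ ∫ ω, V K ω ∂P := by
    simpa using integral_mono_ae (integrable_const Fstar) (hVint K le_rfl) hVK
  have htel := le_sub_sum_range_of_descent (v := fun k => ∫ ω, V k ω ∂P)
    (g := fun k => ∫ ω, G k ω ∂P) hdescent
  have hgap : 8 * ((∫ ω, V 0 ω ∂P) - Fstar) ≤ K * (ε * p * α) :=
    (div_le_iff₀ (by positivity)).mp hKbig
  have hbias : K * (α * χ) ≤ K * (α * (ε * p / 8)) := by gcongr
  have hsum : ∑ k ∈ Finset.range K, ∫ ω, G k ω ∂P ≤ ∑ _k ∈ Finset.range K, ε * p := by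
    rw [Finset.sum_const, Finset.card_range, nsmul_eq_mul]
    refine le_of_mul_le_mul_left ?_ (by positivity : 0 < α / 4)
    linarith
  obtain ⟨k, hk, hGk⟩ := Finset.exists_le_of_sum_le
    (Finset.nonempty_range_iff.mpr (Nat.one_le_iff_ne_zero.mp hK)) hsum
  have hkK := Finset.mem_range.mp hk
  exact (ofReal_one_sub_le_measure_le_of_integral_le hε (hGint k hkK) (hGnonneg k hkK) hGk).trans
    (measure_mono fun ω hω => (Finset.inf'_le (fun k => G k ω) hk).trans (Set.mem_ofPred.mp hω))
end
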